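/- If a homomorphism-closed query Q has a model with a tight edge, then Q has a critical model. -/

import Mathlib

/- Formalization of instances over an arity-two relational signature,
homomorphisms, edges, dissociation, tightness, weights, etc. -/

namespace UR

attribute [local instance] Classical.propDecidable

/-- A fact `R(a,b)` over signature `σ` with constants from `C`. -/
structure Fact (σ C : Type) where
  rel : σ
  fst : C
  snd : C

variable {σ C : Type}

/-- A fact uses a constant. -/
def Fact.uses (F : Fact σ C) (a : C) : Prop := F.fst = a ∨ F.snd = a

/-- An instance is a finite set of facts. -/
abbrev Instance (σ C : Type) := Finset (Fact σ C)

/-- Domain of an instance: constants occurring in its facts. -/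
def dom (I : Instance σ C) : Set C := {a | ∃ F ∈ I, F.uses a}

/-- Applying a map of constants to a fact. -/
def mapFact (f : C → C) (F : Fact σ C) : Fact σ C := ⟨F.rel, f F.fst, f F.snd⟩

/-- `h` is a homomorphism from `I` to `I'`. -/
def IsHom (h : C → C) (I I' : Instance σ C) : Prop := ∀ F ∈ I, mapFact h F ∈ I'

/-- A query is homomorphism-closed. -/
def HomClosed (Q : Instance σ C → Prop) : Prop :=
  ∀ (I I' : Instance σ C) (h : C → C), Q I → IsHom h I I' → Q I'

/-- Covering facts of the pair `(u,v)`: facts using both `u` and `v`. -/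
noncomputable def covering (I : Instance σ C) (u v : C) : Instance σ C :=
  I.filter (fun F => F.uses u ∧ F.uses v)

/-- `(u,v)` is an edge of `I`. -/
def IsEdge (I : Instance σ C) (u v : C) : Prop := u ≠ v ∧ (covering I u v).Nonempty

/-- Left-incident facts of `(u,v)`: facts using `u` but not `v`.
(The right-incident facts of `(u,v)` are `leftIncident I v u`.) -/
noncomputable def leftIncident (I : Instance σ C) (u v : C) : Instance σ C :=
  I.filter (fun F => F.uses u ∧ ¬ F.uses v)

/-- `(u,v)` is a non-leaf edge of `I`. -/
def IsNonLeafEdge (I : Instance σ C) (u v : C) : Prop :=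
  IsEdge I u v ∧ (leftIncident I u v).Nonempty ∧ (leftIncident I v u).Nonempty

/-- The renaming sending `u` to `u'` and `v` to `v'`. -/
noncomputable def rename2 (u v u' v' : C) : C → C := fun a => if a = u then u' else if a = v then v' else a

/-- The renaming sending `a` to `b`. -/
noncomputable def rename1 (a b : C) : C → C := fun x => if x = a then b else x

/-- Copying the edge `(u,v)` of `I` to the ordered pair `(u',v')`. -/
noncomputable def copyEdge (I : Instance σ C) (u v u' v' : C) : Instance σ C :=
  I ∪ (covering I u v).image (mapFact (rename2 u v u' v'))

/-- The dissociation of the non-leaf edge `(u,v)` in `I`, using fresh elements `u'` and `v'`: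
copy `(u,v)` to `(u',v)` and to `(u,v')`, then remove the covering facts of `(u,v)`. -/
noncomputable def dissociation (I : Instance σ C) (u v u' v' : C) : Instance σ C :=
  (I ∪ (covering I u v).image (mapFact (rename2 u v u' v))
     ∪ (covering I u v).image (mapFact (rename2 u v u v'))) \ covering I u v

/-- `(u,v)` is a tight edge of `I` for query `Q`: it is a non-leaf edge, `I` satisfies `Q`, and
the dissociation of `(u,v)` in `I` (with any choice of fresh elements) does not satisfy `Q`. -/
def IsTight (Q : Instance σ C → Prop) (I : Instance σ C) (u v : C) : Prop :=
  IsNonLeafEdge I u v ∧ Q I ∧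
  ∀ u' v' : C, u' ∉ dom I → v' ∉ dom I → u' ≠ v' → ¬ Q (dissociation I u v u' v')

/-- The weight of an edge: number of covering facts. -/
noncomputable def weight (I : Instance σ C) (u v : C) : ℕ := (covering I u v).card

/-- `I` is a subinstance-minimal model of `Q`. -/
def MinimalModel (Q : Instance σ C → Prop) (I : Instance σ C) : Prop :=
  Q I ∧ ∀ J : Instance σ C, J ⊂ I → ¬ Q J

/-- Two instances are isomorphic. -/
def IsIso (I J : Instance σ C) : Prop :=
  ∃ f : C → C, Function.Bijective f ∧ J = I.image (mapFact f)

/-- `Q` is unbounded: it has infinitely many subinstance-minimal models up to isomorphism,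
i.e. no finite set of instances covers all its subinstance-minimal models up to isomorphism. -/
def Unbounded (Q : Instance σ C → Prop) : Prop :=
  ∀ S : Finset (Instance σ C), ∃ I, MinimalModel Q I ∧ ∀ J ∈ S, ¬ IsIso I J

/-- The element `t` witnesses left garbage facts of the edge `(u,v)`: `(u,t)` is an edge whose
covering facts, renamed via `t ↦ v`, form a strict subset of the covering facts of `(u,v)`. -/
def HasLeftGarbage (I : Instance σ C) (u v t : C) : Prop :=
  t ≠ u ∧ t ≠ v ∧ IsEdge I u t ∧
    (covering I u t).image (mapFact (rename1 t v)) ⊂ covering I u v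

/-- The element `w` witnesses right garbage facts of the edge `(u,v)`. -/
def HasRightGarbage (I : Instance σ C) (u v w : C) : Prop :=
  w ≠ u ∧ w ≠ v ∧ IsEdge I w v ∧
    (covering I w v).image (mapFact (rename1 w u)) ⊂ covering I u v

/-- The edge `(u,v)` is clean: no left or right garbage facts. -/
def Clean (I : Instance σ C) (u v : C) : Prop :=
  (∀ t, ¬ HasLeftGarbage I u v t) ∧ (∀ w, ¬ HasRightGarbage I u v w)

/-- `F` is a left garbage fact of `(u,v)`. -/
def IsLeftGarbageFact (I : Instance σ C) (u v : C) (F : Fact σ C) : Prop :=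
  ∃ t, HasLeftGarbage I u v t ∧ F ∈ covering I u t

/-- `F` is a right garbage fact of `(u,v)`. -/
def IsRightGarbageFact (I : Instance σ C) (u v : C) (F : Fact σ C) : Prop :=
  ∃ w, HasRightGarbage I u v w ∧ F ∈ covering I w v

/-- `x` forms a triangle with the edge `(u,v)`. -/
def Triangle (I : Instance σ C) (u v x : C) : Prop := IsEdge I u x ∧ IsEdge I v x

/-- The edge `(u',v')` is a copy of the edge `(u,v)`: its covering facts are exactly the image
of the covering facts of `(u,v)` under the renaming `u ↦ u'`, `v ↦ v'`. -/
def IsCopy (I : Instance σ C) (u v u' v' : C) : Prop :=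
  u' ≠ v' ∧ covering I u' v' = (covering I u v).image (mapFact (rename2 u v u' v'))

/-- `v'` is a left copy element of `(u,v)`. -/
def IsLeftCopyElem (I : Instance σ C) (u v v' : C) : Prop :=
  v' ≠ u ∧ v' ≠ v ∧ IsCopy I u v u v' ∧ ¬ Triangle I u v v'

/-- `u'` is a right copy element of `(u,v)`. -/
def IsRightCopyElem (I : Instance σ C) (u v u' : C) : Prop :=
  u' ≠ u ∧ u' ≠ v ∧ IsCopy I u v u' v ∧ ¬ Triangle I u v u'

/-- `F` is a left copy fact of `(u,v)`. -/
def IsLeftCopyFact (I : Instance σ C) (u v : C) (F : Fact σ C) : Prop :=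
  F ∈ leftIncident I u v ∧ ∃ v', IsLeftCopyElem I u v v' ∧ F.uses v'

/-- `F` is a right copy fact of `(u,v)`. -/
def IsRightCopyFact (I : Instance σ C) (u v : C) (F : Fact σ C) : Prop :=
  F ∈ leftIncident I v u ∧ ∃ u', IsRightCopyElem I u v u' ∧ F.uses u'

/-- `F` is a left extra fact of `(u,v)`: a non-garbage left-incident fact which is unary on `u`,
or binary on `u` and an element `x` forming a triangle with `(u,v)` or such that the covering
facts of `(u,x)` are not isomorphic to those of `(u,v)`. -/
def IsLeftExtraFact (I : Instance σ C) (u v : C) (F : Fact σ C) : Prop :=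
  F ∈ leftIncident I u v ∧ ¬ IsLeftGarbageFact I u v F ∧
    ((F.fst = u ∧ F.snd = u) ∨
      ∃ x, x ≠ u ∧ F.uses x ∧ (Triangle I u v x ∨ ¬ IsCopy I u v u x))

/-- `F` is a right extra fact of `(u,v)`. -/
def IsRightExtraFact (I : Instance σ C) (u v : C) (F : Fact σ C) : Prop :=
  F ∈ leftIncident I v u ∧ ¬ IsRightGarbageFact I u v F ∧
    ((F.fst = v ∧ F.snd = v) ∨
      ∃ x, x ≠ v ∧ F.uses x ∧ (Triangle I u v x ∨ ¬ IsCopy I u v x v))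

/-- The extra weight of `(u,v)`: number of extra facts. -/
noncomputable def extraWeight (I : Instance σ C) (u v : C) : ℕ :=
  (I.filter (fun F => IsLeftExtraFact I u v F ∨ IsRightExtraFact I u v F)).card

/-- The finite set of constants occurring in `I`. -/
noncomputable def constsOf (I : Instance σ C) : Finset C :=
  I.image Fact.fst ∪ I.image Fact.snd

/-- The lexicographic weight of `(u,v)`: the pair (number of left copy elements,
number of right copy elements). -/
noncomputable def lexWeight (I : Instance σ C) (u v : C) : ℕ × ℕ :=
  (((constsOf I).filter (fun v' => IsLeftCopyElem I u v v')).card,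
   ((constsOf I).filter (fun u' => IsRightCopyElem I u v u')).card)

/-- Lexicographic comparison of pairs of naturals. -/
def lexLt (p q : ℕ × ℕ) : Prop := p.1 < q.1 ∨ (p.1 = q.1 ∧ p.2 < q.2)

end UR

namespace UR

section helpers

attribute [local instance] Classical.propDecidable

variable {σ C : Type}

lemma mem_cov {I : Instance σ C} {u v : C} {F : Fact σ C} :
    F ∈ covering I u v ↔ F ∈ I ∧ F.uses u ∧ F.uses v := by simp [covering]

lemma mem_inc {I : Instance σ C} {u v : C} {F : Fact σ C} :
    F ∈ leftIncident I u v ↔ F ∈ I ∧ F.uses u ∧ ¬ F.uses v := by simp [leftIncident]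

lemma cov_comm (I : Instance σ C) (u v : C) : covering I u v = covering I v u := by
  ext F; simp only [mem_cov]; tauto

lemma uses_cases {F : Fact σ C} {u v : C} (h : u ≠ v) (hu : F.uses u) (hv : F.uses v) :
    F = ⟨F.rel, u, v⟩ ∨ F = ⟨F.rel, v, u⟩ := by
  obtain ⟨r, a, b⟩ := F
  simp only [Fact.uses, Fact.mk.injEq, true_and] at *
  grind

lemma map_congr {F : Fact σ C} {f g : C → C} (h : ∀ a, F.uses a → f a = g a) :
    mapFact f F = mapFact g F := by
  simp [mapFact, h F.fst (Or.inl rfl), h F.snd (Or.inr rfl)]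

lemma map_fix {F : Fact σ C} {f : C → C} (h : ∀ a, F.uses a → f a = a) :
    mapFact f F = F := by
  simp [mapFact, h F.fst (Or.inl rfl), h F.snd (Or.inr rfl)]

lemma map_map (F : Fact σ C) (f g : C → C) : mapFact f (mapFact g F) = mapFact (f ∘ g) F := rfl

lemma uses_map {F : Fact σ C} {f : C → C} {a : C} :
    (mapFact f F).uses a ↔ ∃ b, F.uses b ∧ f b = a := by
  simp [mapFact, Fact.uses]

lemma only_two {F : Fact σ C} {u v a : C} (h : u ≠ v) (hu : F.uses u) (hv : F.uses v)
    (ha : F.uses a) : a = u ∨ a = v := by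
  simp only [Fact.uses] at *
  grind

lemma edge_comm {I : Instance σ C} {u v : C} : IsEdge I u v ↔ IsEdge I v u := by
  unfold IsEdge; rw [cov_comm I u v, ne_comm]

lemma tri_comm {I : Instance σ C} {u v x : C} : Triangle I u v x ↔ Triangle I v u x := by
  unfold Triangle; tauto

lemma rename2_comm {u v : C} (h : u ≠ v) (x y : C) : rename2 u v x y = rename2 v u y x := by
  funext a; simp only [rename2]; grind

lemma copy_comm {I : Instance σ C} {u v : C} (h : u ≠ v) (x y : C) :
    IsCopy I u v x y ↔ IsCopy I v u y x := by
  unfold IsCopy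
  rw [cov_comm I x y, cov_comm I u v, rename2_comm h, ne_comm]

lemma garb_comm {I : Instance σ C} {u v w : C} :
    HasRightGarbage I u v w ↔ HasLeftGarbage I v u w := by
  unfold HasRightGarbage HasLeftGarbage
  rw [cov_comm I w v, cov_comm I u v, edge_comm (u := w)]; tauto

lemma garbF_comm {I : Instance σ C} {u v : C} {F : Fact σ C} :
    IsRightGarbageFact I u v F ↔ IsLeftGarbageFact I v u F := by
  unfold IsRightGarbageFact IsLeftGarbageFact
  simp only [garb_comm, cov_comm I v]

lemma elem_comm {I : Instance σ C} {u v : C} (h : u ≠ v) (x : C) :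
    IsRightCopyElem I u v x ↔ IsLeftCopyElem I v u x := by
  unfold IsRightCopyElem IsLeftCopyElem
  rw [copy_comm h, tri_comm]; tauto

lemma extra_comm {I : Instance σ C} {u v : C} (h : u ≠ v) (F : Fact σ C) :
    IsRightExtraFact I u v F ↔ IsLeftExtraFact I v u F := by
  unfold IsRightExtraFact IsLeftExtraFact
  simp only [copy_comm h, tri_comm (u := u), garbF_comm]

/-- Facts of `K` touching `u` or `v` are in `I`. -/
def Touch (K I : Instance σ C) (u v : C) : Prop :=
  ∀ F ∈ K, (F.uses u ∨ F.uses v) → F ∈ I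

lemma Touch.symm {K I : Instance σ C} {u v : C} (T : Touch K I u v) : Touch K I v u :=
  fun F hF h => T F hF h.symm

lemma Touch.cov {K I : Instance σ C} {u v : C} (T : Touch K I u v) (x : C) :
    covering K u x ⊆ covering I u x := by
  intro F hF
  rw [mem_cov] at *
  exact ⟨T F hF.1 (Or.inl hF.2.1), hF.2⟩

lemma Touch.edge {K I : Instance σ C} {u v x : C} (T : Touch K I u v) (h : IsEdge K u x) :
    IsEdge I u x := ⟨h.1, h.2.mono (T.cov x)⟩

lemma Touch.tri {K I : Instance σ C} {u v x : C} (T : Touch K I u v) (h : Triangle K u v x) :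
    Triangle I u v x := ⟨T.edge h.1, T.symm.edge h.2⟩

lemma ren_back {I : Instance σ C} {u v x : C} (huv : u ≠ v) (hxu : x ≠ u) (hxv : x ≠ v) :
    ((covering I u v).image (mapFact (rename2 u v u x))).image (mapFact (rename1 x v))
      = covering I u v := by
  rw [Finset.image_image]
  conv_rhs => rw [← Finset.image_id (s := covering I u v)]
  refine Finset.image_congr ?_
  intro F hF
  have hF := mem_cov.1 (Finset.mem_coe.1 hF)
  simp only [Function.comp, map_map]
  refine map_fix ?_
  intro a ha
  rcases only_two huv hF.2.1 hF.2.2 ha with rfl | rfl <;> simp [rename1, rename2] <;> grind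

lemma ren_forth {I : Instance σ C} {u v x : C} (huv : u ≠ v) (hxu : x ≠ u) (hxv : x ≠ v) :
    ((covering I u x).image (mapFact (rename1 x v))).image (mapFact (rename2 u v u x))
      = covering I u x := by
  rw [Finset.image_image]
  conv_rhs => rw [← Finset.image_id (s := covering I u x)]
  refine Finset.image_congr ?_
  intro F hF
  have hF := mem_cov.1 (Finset.mem_coe.1 hF)
  simp only [Function.comp, map_map]
  refine map_fix ?_
  intro a ha
  rcases only_two hxu.symm hF.2.1 hF.2.2 ha with rfl | rfl <;> simp [rename1, rename2] <;> grind

lemma extra_left {K I : Instance σ C} {u v : C} (huv : u ≠ v) (T : Touch K I u v)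
    (hc : covering K u v = covering I u v) {F : Fact σ C}
    (h : IsLeftExtraFact K u v F) : IsLeftExtraFact I u v F := by
  obtain ⟨h1, h2, h3⟩ := h
  rw [mem_inc] at h1
  refine ⟨mem_inc.2 ⟨T F h1.1 (Or.inl h1.2.1), h1.2⟩, ?_, ?_⟩
  · rintro ⟨t, ⟨g1, g2, g3, g4⟩, g5⟩
    have hFt : F ∈ covering K u t := mem_cov.2 ⟨h1.1, (mem_cov.1 g5).2⟩
    refine h2 ⟨t, ⟨g1, g2, ⟨g3.1, ⟨F, hFt⟩⟩, ?_⟩, hFt⟩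
    rw [hc]
    exact lt_of_le_of_lt (Finset.image_subset_image (T.cov t)) g4
  · rcases h3 with h3 | ⟨x, hxu, hFx, hx⟩
    · exact Or.inl h3
    right
    refine ⟨x, hxu, hFx, ?_⟩
    by_contra hcon
    push Not at hcon
    obtain ⟨hnt, hcopy⟩ := hcon
    have hnc : ¬ IsCopy K u v u x := hx.resolve_left (fun h => hnt (T.tri h))
    have hxv : x ≠ v := by rintro rfl; exact h1.2.2 hFx
    have hFt : F ∈ covering K u x := mem_cov.2 ⟨h1.1, h1.2.1, hFx⟩
    refine h2 ⟨x, ⟨hxu, hxv, ⟨hxu.symm, ⟨F, hFt⟩⟩, ?_⟩, hFt⟩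
    refine lt_of_le_of_ne ?_ ?_
    · have := Finset.image_subset_image (f := mapFact (rename1 x v)) (T.cov x)
      rw [hcopy.2, ren_back huv hxu hxv, ← hc] at this
      exact this
    · intro he
      refine hnc ⟨hxu.symm, ?_⟩
      rw [← he, ren_forth huv hxu hxv]

lemma copy_left {K I : Instance σ C} {u v : C} (huv : u ≠ v) (T : Touch K I u v)
    (hc : covering K u v = covering I u v) (hne : (covering K u v).Nonempty) {x : C}
    (h : IsLeftCopyElem K u v x) : IsLeftCopyElem I u v x ∨
      ∃ F, IsLeftExtraFact I u v F ∧ ¬ IsLeftExtraFact K u v F ∧ ¬ IsLeftExtraFact K v u F := by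
  obtain ⟨hxu, hxv, hcopy, hnt⟩ := h
  by_cases hI : IsLeftCopyElem I u v x
  · exact Or.inl hI
  right
  have hne' : (covering K u x).Nonempty := by rw [hcopy.2]; exact hne.image _
  obtain ⟨F, hF⟩ := hne'
  have hF' := mem_cov.1 hF
  have hFI := mem_cov.1 (T.cov x hF)
  have hFv : ¬ F.uses v := by
    intro h
    rcases only_two hxu.symm hF'.2.1 hF'.2.2 h with h | h
    · exact huv h.symm
    · exact hxv h.symm
  refine ⟨F, ⟨mem_inc.2 ⟨hFI.1, hFI.2.1, hFv⟩, ?_, Or.inr ⟨x, hxu, hFI.2.2, ?_⟩⟩, ?_, ?_⟩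
  · rintro ⟨t, ⟨g1, g2, g3, g4⟩, g5⟩
    have htx : t = x := (only_two hxu.symm hF'.2.1 hF'.2.2 (mem_cov.1 g5).2.2).resolve_left g1
    subst htx
    have := Finset.image_subset_image (f := mapFact (rename1 t v)) (T.cov t)
    rw [hcopy.2, ren_back huv hxu hxv, hc] at this
    exact absurd (lt_of_le_of_lt this g4) (lt_irrefl _)
  · by_contra hcon
    push Not at hcon
    exact hI ⟨hxu, hxv, hcon.2, hcon.1⟩
  · rintro ⟨-, -, h | ⟨y, hyu, hFy, hy⟩⟩
    · have := hF'.2.2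
      simp only [Fact.uses, h] at this
      grind
    · have hyx : y = x := (only_two hxu.symm hF'.2.1 hF'.2.2 hFy).resolve_left hyu
      subst hyx
      grind
  · rintro ⟨h, -⟩
    exact hFv (mem_inc.1 h).2.1

lemma cov_inst (I : Instance σ C) (u v : C) (hne : (covering I u v).Nonempty) : v ∈ constsOf I := by
  obtain ⟨F, hF⟩ := hne
  have := mem_cov.1 hF
  simp only [constsOf, Finset.mem_union, Finset.mem_image]
  rcases this.2.2 with h | h
  · exact Or.inl ⟨F, this.1, h⟩
  · exact Or.inr ⟨F, this.1, h⟩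

lemma mem_dom {I : Instance σ C} {a : C} {F : Fact σ C} (h : F ∈ I) (ha : F.uses a) : a ∈ dom I :=
  ⟨F, h, ha⟩

lemma dom_finite (I : Instance σ C) : (dom I).Finite := by
  refine (constsOf I).finite_toSet.subset ?_
  rintro a ⟨F, hF, h⟩
  simp only [constsOf, Finset.coe_union, Finset.coe_image]
  rcases h with h | h
  · exact Or.inl ⟨F, hF, h⟩
  · exact Or.inr ⟨F, hF, h⟩

lemma exists_fresh [Infinite C] (I : Instance σ C) :
    ∃ a b : C, a ∉ dom I ∧ b ∉ dom I ∧ a ≠ b := by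
  obtain ⟨a, ha⟩ := (dom_finite I).exists_notMem
  obtain ⟨b, hb⟩ := ((dom_finite I).insert a).exists_notMem
  simp only [Set.mem_insert_iff, not_or] at hb
  exact ⟨a, b, ha, hb.2, fun h => hb.1 h.symm⟩

lemma diss_of_not {I : Instance σ C} {u v a b : C} {F : Fact σ C} (hF : F ∈ I)
    (h : ¬ (F.uses u ∧ F.uses v)) : F ∈ dissociation I u v a b := by
  simp only [dissociation, Finset.mem_sdiff, Finset.mem_union, mem_cov]
  tauto

lemma diss_left {I : Instance σ C} {u v a b : C} (huv : u ≠ v) {F : Fact σ C}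
    (hF : F ∈ covering I u v) (ha : a ≠ u) :
    mapFact (rename2 u v a v) F ∈ dissociation I u v a b := by
  simp only [dissociation, Finset.mem_sdiff, Finset.mem_union]
  refine ⟨Or.inl (Or.inr (Finset.mem_image_of_mem _ hF)), ?_⟩
  intro h
  obtain ⟨c, hc, h⟩ := uses_map.1 (mem_cov.1 h).2.1
  have hF := mem_cov.1 hF
  rcases only_two huv hF.2.1 hF.2.2 hc with rfl | rfl <;> simp [rename2] at h <;> grind

lemma diss_right {I : Instance σ C} {u v a b : C} (huv : u ≠ v) {F : Fact σ C}
    (hF : F ∈ covering I u v) (hb : b ≠ v) :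
    mapFact (rename2 u v u b) F ∈ dissociation I u v a b := by
  simp only [dissociation, Finset.mem_sdiff, Finset.mem_union]
  refine ⟨Or.inr (Finset.mem_image_of_mem _ hF), ?_⟩
  intro h
  obtain ⟨c, hc, h⟩ := uses_map.1 (mem_cov.1 h).2.2
  have hF := mem_cov.1 hF
  rcases only_two huv hF.2.1 hF.2.2 hc with rfl | rfl <;> simp [rename2] at h <;> grind

/-- `K` retracts on `I` compatibly with the edge `(u,v)`. -/
def Ret (K I : Instance σ C) (u v : C) : Prop :=
  ∃ g : C → C, g u = u ∧ g v = v ∧ IsHom g K I ∧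
    ∀ F ∈ K, ¬ (F.uses u ∧ F.uses v) → ¬ ((mapFact g F).uses u ∧ (mapFact g F).uses v)

lemma Ret.symm {K I : Instance σ C} {u v : C} (h : Ret K I u v) : Ret K I v u := by
  obtain ⟨g, h1, h2, h3, h4⟩ := h
  exact ⟨g, h2, h1, h3, fun F hF h => by have := h4 F hF; tauto⟩

lemma tight_transfer [Infinite C] {Q : Instance σ C → Prop} (hQ : HomClosed Q)
    {K I : Instance σ C} {u v : C} (T : Touch K I u v) (R : Ret K I u v) (hK : Q K)
    (hI : IsTight Q I u v) : IsTight Q K u v := by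
  obtain ⟨g, gu, gv, ghom, gnc⟩ := R
  obtain ⟨⟨⟨huv, hne⟩, -, -⟩, -, hI⟩ := hI
  obtain ⟨a, b, ha, hb, hab⟩ := exists_fresh I
  have hnot := hI a b ha hb hab
  obtain ⟨F0, hF0⟩ := hne
  have hF0 := mem_cov.1 hF0
  have hau : a ≠ u := by rintro rfl; exact ha (mem_dom hF0.1 hF0.2.1)
  have hbv : b ≠ v := by rintro rfl; exact hb (mem_dom hF0.1 hF0.2.2)
  have hbase : ∀ F ∈ K, ¬ (F.uses u ∧ F.uses v) → mapFact g F ∈ dissociation I u v a b :=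
    fun F hF h => diss_of_not (ghom F hF) (gnc F hF h)
  have hedge : (covering K u v).Nonempty := by
    by_contra hcon
    refine hnot (hQ K _ g hK ?_)
    intro F hF
    exact hbase F hF fun h => hcon ⟨F, mem_cov.2 ⟨hF, h⟩⟩
  have hl : (leftIncident K u v).Nonempty := by
    by_contra hcon
    refine hnot (hQ K _ (fun c => if c = u then a else g c) hK ?_)
    intro F hF
    by_cases hFu : F.uses u
    · have hFv : F.uses v := by
        by_contra h
        exact hcon ⟨F, mem_inc.2 ⟨hF, hFu, h⟩⟩
      have := diss_left (b := b) huv (mem_cov.2 ⟨T F hF (Or.inl hFu), hFu, hFv⟩) hau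
      convert this using 1
      refine map_congr ?_
      intro c hc
      rcases only_two huv hFu hFv hc with rfl | rfl <;> simp [rename2] <;> grind
    · have := hbase F hF (fun h => hFu h.1)
      convert this using 1
      refine map_congr ?_
      intro c hc
      grind
  have hr : (leftIncident K v u).Nonempty := by
    by_contra hcon
    refine hnot (hQ K _ (fun c => if c = v then b else g c) hK ?_)
    intro F hF
    by_cases hFv : F.uses v
    · have hFu : F.uses u := by
        by_contra h
        exact hcon ⟨F, mem_inc.2 ⟨hF, hFv, h⟩⟩
      have := diss_right (a := a) huv (mem_cov.2 ⟨T F hF (Or.inl hFu), hFu, hFv⟩) hbv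
      convert this using 1
      refine map_congr ?_
      intro c hc
      rcases only_two huv hFu hFv hc with rfl | rfl <;> simp [rename2] <;> grind
    · have := hbase F hF (fun h => hFv h.2)
      convert this using 1
      refine map_congr ?_
      intro c hc
      grind
  refine ⟨⟨⟨huv, hedge⟩, hl, hr⟩, hK, ?_⟩
  intro a' b' ha' hb' hab' hdis
  obtain ⟨F1, hF1⟩ := hedge
  have hF1 := mem_cov.1 hF1
  have hu : u ∈ dom K := mem_dom hF1.1 hF1.2.1
  have hv : v ∈ dom K := mem_dom hF1.1 hF1.2.2
  refine hnot (hQ _ _ (fun c => if c = a' then a else if c = b' then b else g c) hdis ?_)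
  intro F hF
  simp only [dissociation, Finset.mem_sdiff, Finset.mem_union, Finset.mem_image] at hF
  obtain ⟨(hF | ⟨G, hG, rfl⟩) | ⟨G, hG, rfl⟩, hnc⟩ := hF
  · have := hbase F hF (fun h => hnc (mem_cov.2 ⟨hF, h⟩))
    convert this using 1
    refine map_congr ?_
    intro c hc
    have hc : c ∈ dom K := mem_dom hF hc
    grind
  · have := diss_left (b := b) huv (T.cov v hG) hau
    convert this using 1
    rw [map_map]
    refine map_congr ?_
    intro c hc
    have hG := mem_cov.1 hG
    rcases only_two huv hG.2.1 hG.2.2 hc with rfl | rfl <;> simp [rename2] <;> grind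
  · have := diss_right (a := a) huv (T.cov v hG) hbv
    convert this using 1
    rw [map_map]
    refine map_congr ?_
    intro c hc
    have hG := mem_cov.1 hG
    rcases only_two huv hG.2.1 hG.2.2 hc with rfl | rfl <;> simp [rename2] <;> grind

/-- Facts touching `u` or `v`. -/
noncomputable def touching (I : Instance σ C) (u v : C) : Instance σ C :=
  I.filter (fun F => F.uses u ∨ F.uses v)

lemma touching_comm (I : Instance σ C) (u v : C) : touching I u v = touching I v u := by
  ext F; simp only [touching, Finset.mem_filter]; tauto

lemma garbage_step [Infinite C] {Q : Instance σ C → Prop} (hQ : HomClosed Q)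
    {I : Instance σ C} {u v t : C} (huv : u ≠ v) (hI : Q I)
    (hmin : ∀ x y, IsTight Q I x y → weight I u v ≤ weight I x y)
    (hne : (covering I u v).Nonempty) (hg : HasLeftGarbage I u v t) :
    ∃ K, Q K ∧ Touch K I u v ∧ Ret K I u v ∧ touching K u v ⊂ touching I u v := by
  obtain ⟨htu, htv, ⟨-, hne_t⟩, hss⟩ := hg
  obtain ⟨F0, hF0⟩ := hne
  have hF0 := mem_cov.1 hF0
  have hu : u ∈ dom I := mem_dom hF0.1 hF0.2.1
  have hv : v ∈ dom I := mem_dom hF0.1 hF0.2.2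
  obtain ⟨F1, hF1'⟩ := hne_t
  have hF1 := mem_cov.1 hF1'
  have ht : t ∈ dom I := mem_dom hF1.1 hF1.2.2
  have hw : weight I u t < weight I u v := by
    have h1 := Finset.card_lt_card hss
    have h2 : (covering I u t).card ≤
        ((covering I u t).image (mapFact (rename1 t v))).card := by
      conv_lhs => rw [← ren_forth (I := I) huv htu htv]
      exact Finset.card_image_le
    exact lt_of_le_of_lt h2 h1
  have hnt : ¬ IsTight Q I u t := fun h => absurd (hmin u t h) (not_le.2 hw)
  have hF0t : ∀ F : Fact σ C, F.uses u → F.uses v → ¬ F.uses t := by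
    intro F h1 h2 h3
    rcases only_two huv h1 h2 h3 with h | h
    · exact htu h
    · exact htv h
  have htov : ∀ F ∈ covering I u t, mapFact (rename1 t v) F ∈ I ∧
      ¬ ((mapFact (rename1 t v) F).uses u ∧ (mapFact (rename1 t v) F).uses t) := by
    intro F hF
    have := mem_cov.1 (hss.1 (Finset.mem_image_of_mem _ hF))
    exact ⟨this.1, fun h => hF0t _ this.2.1 this.2.2 h.2⟩
  obtain ⟨a, ha, hK⟩ : ∃ a, a ∉ dom I ∧
      Q ((I \ covering I u t) ∪ (covering I u t).image (mapFact (rename2 u t a t))) := by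
    by_cases hleaf : (leftIncident I t u).Nonempty
    · have hnl : IsNonLeafEdge I u t := by
        refine ⟨⟨htu.symm, ⟨F1, hF1'⟩⟩, ⟨F0, mem_inc.2 ⟨hF0.1, hF0.2.1, ?_⟩⟩, hleaf⟩
        exact hF0t _ hF0.2.1 hF0.2.2
      unfold IsTight at hnt
      push Not at hnt
      obtain ⟨a, b, ha, hb, hab, hq⟩ := hnt hnl hI
      refine ⟨a, ha, hQ _ _ (rename1 b v) hq ?_⟩
      intro F hF
      simp only [dissociation, Finset.mem_sdiff, Finset.mem_union, Finset.mem_image] at hF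
      obtain ⟨(hF | ⟨G, hG, rfl⟩) | ⟨G, hG, rfl⟩, hnc⟩ := hF
      · rw [map_fix]
        · exact Finset.mem_union_left _ (Finset.mem_sdiff.2 ⟨hF, hnc⟩)
        · intro c hc
          have := mem_dom hF hc
          simp only [rename1]
          grind
      · rw [map_fix]
        · exact Finset.mem_union_right _ (Finset.mem_image_of_mem _ hG)
        · intro c hc
          obtain ⟨d, hd, rfl⟩ := uses_map.1 hc
          have hG := mem_cov.1 hG
          rcases only_two htu.symm hG.2.1 hG.2.2 hd with rfl | rfl <;>
            simp [rename1, rename2] <;> grind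
      · have h := htov G hG
        have he : mapFact (rename1 b v) (mapFact (rename2 u t u b) G) = mapFact (rename1 t v) G := by
          rw [map_map]
          refine map_congr ?_
          intro d hd
          have hG := mem_cov.1 hG
          rcases only_two htu.symm hG.2.1 hG.2.2 hd with rfl | rfl <;>
            simp [rename1, rename2] <;> grind
        rw [he]
        exact Finset.mem_union_left _ (Finset.mem_sdiff.2 ⟨h.1, fun h' => h.2 (mem_cov.1 h').2⟩)
    · obtain ⟨a, b, ha, -, -⟩ := exists_fresh I
      refine ⟨a, ha, hQ _ _ (rename1 t v) hI ?_⟩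
      intro F hF
      by_cases hFt : F.uses t
      · have hFu : F.uses u := by
          by_contra h
          exact hleaf ⟨F, mem_inc.2 ⟨hF, hFt, h⟩⟩
        have h := htov F (mem_cov.2 ⟨hF, hFu, hFt⟩)
        exact Finset.mem_union_left _ (Finset.mem_sdiff.2 ⟨h.1, fun h' => h.2 (mem_cov.1 h').2⟩)
      · rw [map_fix]
        · exact Finset.mem_union_left _ (Finset.mem_sdiff.2 ⟨hF, fun h' => hFt (mem_cov.1 h').2.2⟩)
        · intro c hc
          simp only [rename1]
          grind
  have hcopy : ∀ G ∈ covering I u t, ∀ c, (mapFact (rename2 u t a t) G).uses c → c = a ∨ c = t := by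
    intro G hG c hc
    obtain ⟨d, hd, rfl⟩ := uses_map.1 hc
    have hG := mem_cov.1 hG
    rcases only_two htu.symm hG.2.1 hG.2.2 hd with rfl | rfl <;> simp only [rename2] <;> grind
  have hau : a ≠ u := by rintro rfl; exact ha hu
  have hav : a ≠ v := by rintro rfl; exact ha hv
  have T : Touch ((I \ covering I u t) ∪ (covering I u t).image (mapFact (rename2 u t a t))) I u v := by
    intro F hF h
    rcases Finset.mem_union.1 hF with hF | hF
    · exact (Finset.mem_sdiff.1 hF).1
    · obtain ⟨G, hG, rfl⟩ := Finset.mem_image.1 hF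
      exfalso
      rcases h with h | h <;> have := hcopy G hG _ h <;> grind
  refine ⟨_, hK, T, ?_, ?_⟩
  · have hfix : ∀ F ∈ I, mapFact (rename1 a u) F = F := by
      intro F hF
      refine map_fix ?_
      intro c hc
      have := mem_dom hF hc
      simp only [rename1]
      grind
    have hback : ∀ G ∈ covering I u t, mapFact (rename1 a u) (mapFact (rename2 u t a t) G) = G := by
      intro G hG
      rw [map_map]
      refine map_fix ?_
      intro d hd
      have hG := mem_cov.1 hG
      rcases only_two htu.symm hG.2.1 hG.2.2 hd with rfl | rfl <;>
        simp [rename1, rename2] <;> grind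
    refine ⟨rename1 a u, by simp [rename1], by simp only [rename1]; grind, ?_, ?_⟩
    · intro F hF
      rcases Finset.mem_union.1 hF with hF | hF
      · have hF := (Finset.mem_sdiff.1 hF).1
        rw [hfix F hF]; exact hF
      · obtain ⟨G, hG, rfl⟩ := Finset.mem_image.1 hF
        rw [hback G hG]; exact (mem_cov.1 hG).1
    · intro F hF h
      rcases Finset.mem_union.1 hF with hF | hF
      · have hF := (Finset.mem_sdiff.1 hF).1
        rw [hfix F hF]; exact h
      · obtain ⟨G, hG, rfl⟩ := Finset.mem_image.1 hF
        rw [hback G hG]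
        exact fun h => hF0t G h.1 h.2 (mem_cov.1 hG).2.2
  · refine Finset.ssubset_iff_of_subset ?_ |>.2 ⟨F1, ?_, ?_⟩
    · intro F hF
      simp only [touching, Finset.mem_filter] at hF ⊢
      exact ⟨T F hF.1 hF.2, hF.2⟩
    · exact Finset.mem_filter.2 ⟨hF1.1, Or.inl hF1.2.1⟩
    · intro h
      have h := (Finset.mem_filter.1 h).1
      rcases Finset.mem_union.1 h with hF | hF
      · exact (Finset.mem_sdiff.1 hF).2 hF1'
      · obtain ⟨G, hG, he⟩ := Finset.mem_image.1 hF
        have := hcopy G hG u (by rw [he]; exact hF1.2.1)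
        grind

lemma extra_sub {K I : Instance σ C} {u v : C} (huv : u ≠ v) (T : Touch K I u v)
    (hc : covering K u v = covering I u v) :
    K.filter (fun F => IsLeftExtraFact K u v F ∨ IsRightExtraFact K u v F) ⊆
    I.filter (fun F => IsLeftExtraFact I u v F ∨ IsRightExtraFact I u v F) := by
  have hc' : covering K v u = covering I v u := by rw [cov_comm, hc, cov_comm]
  intro F hF
  simp only [Finset.mem_filter, extra_comm huv] at hF ⊢
  rcases hF.2 with h | h
  · have := extra_left huv T hc h
    exact ⟨(mem_inc.1 this.1).1, Or.inl this⟩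
  · have := extra_left huv.symm T.symm hc' h
    exact ⟨(mem_inc.1 this.1).1, Or.inr this⟩

lemma elem_const {I : Instance σ C} {u v x : C} (hne : (covering I u v).Nonempty)
    (h : IsLeftCopyElem I u v x) : x ∈ constsOf I := by
  refine cov_inst I u x ?_
  rw [h.2.2.1.2]
  exact hne.image _

lemma params_transfer [Infinite C] {Q : Instance σ C → Prop} (hQ : HomClosed Q)
    {Θ Ξ : ℕ} {Λ : ℕ × ℕ}
    (hΘ_min : ∀ (I : Instance σ C) (u v : C), IsTight Q I u v → Θ ≤ weight I u v)
    (hΞ_min : ∀ (I : Instance σ C) (u v : C), IsTight Q I u v → weight I u v = Θ →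
      Ξ ≤ extraWeight I u v)
    (hΛ_min : ∀ (I : Instance σ C) (u v : C), IsTight Q I u v → weight I u v = Θ →
      extraWeight I u v = Ξ → ¬ lexLt (lexWeight I u v) Λ)
    {K I : Instance σ C} {u v : C} (T : Touch K I u v) (R : Ret K I u v) (hK : Q K)
    (hI : IsTight Q I u v) (h1 : weight I u v = Θ) (h2 : extraWeight I u v = Ξ)
    (h3 : lexWeight I u v = Λ) :
    IsTight Q K u v ∧ weight K u v = Θ ∧ extraWeight K u v = Ξ ∧ lexWeight K u v = Λ := by
  have hKt := tight_transfer hQ T R hK hI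
  have huv : u ≠ v := hI.1.1.1
  have hc : covering K u v = covering I u v := by
    refine Finset.eq_of_subset_of_card_le (T.cov v) ?_
    have := hΘ_min K u v hKt
    rw [← h1] at this
    exact this
  have hw : weight K u v = Θ := by rw [← h1]; simp only [weight, hc]
  have hneK := hKt.1.1.2
  have hc' : covering K v u = covering I v u := by rw [cov_comm, hc, cov_comm]
  have hneK' : (covering K v u).Nonempty := by rw [cov_comm]; exact hneK
  have hneI' : (covering I v u).Nonempty := by rw [← hc']; exact hneK'
  have hes := Finset.eq_of_subset_of_card_le (extra_sub huv T hc) (by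
    have := hΞ_min K u v hKt hw
    rw [← h2] at this
    exact this)
  have hew : extraWeight K u v = Ξ := by
    rw [← h2]; unfold extraWeight; rw [hes]
  have hiff : ∀ F, IsLeftExtraFact I u v F ∨ IsLeftExtraFact I v u F →
      IsLeftExtraFact K u v F ∨ IsLeftExtraFact K v u F := by
    intro F hF
    have hFI : F ∈ I := by
      rcases hF with h | h
      · exact (mem_inc.1 h.1).1
      · exact (mem_inc.1 h.1).1
    rw [← extra_comm huv] at hF
    have : F ∈ I.filter (fun F => IsLeftExtraFact I u v F ∨ IsRightExtraFact I u v F) :=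
      Finset.mem_filter.2 ⟨hFI, hF⟩
    rw [← hes] at this
    have := (Finset.mem_filter.1 this).2
    rwa [extra_comm huv] at this
  have hL : (constsOf K).filter (fun x => IsLeftCopyElem K u v x) ⊆
      (constsOf I).filter (fun x => IsLeftCopyElem I u v x) := by
    intro x hx
    have hx := (Finset.mem_filter.1 hx).2
    rcases copy_left huv T hc hneK hx with h | ⟨F, hF, hF1, hF2⟩
    · exact Finset.mem_filter.2 ⟨elem_const hI.1.1.2 h, h⟩
    · have := hiff F (Or.inl hF); tauto
  have hR : (constsOf K).filter (fun x => IsRightCopyElem K u v x) ⊆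
      (constsOf I).filter (fun x => IsRightCopyElem I u v x) := by
    intro x hx
    have hx := (Finset.mem_filter.1 hx).2
    rw [elem_comm huv] at hx
    rcases copy_left huv.symm T.symm hc' hneK' hx with h | ⟨F, hF, hF1, hF2⟩
    · exact Finset.mem_filter.2 ⟨elem_const hneI' h, (elem_comm huv x).2 h⟩
    · have := hiff F (Or.inr hF); tauto
  have hL' := Finset.card_le_card hL
  have hR' := Finset.card_le_card hR
  refine ⟨hKt, hw, hew, ?_⟩
  have hlex := hΛ_min K u v hKt hw hew
  rw [← h3] at hlex ⊢
  unfold lexLt at hlex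
  simp only [lexWeight] at hlex ⊢
  ext <;> simp only <;> omega

/-- Main existence lemma. -/
lemma main_aux [Infinite C]
    (Q : Instance σ C → Prop) (hQ : HomClosed Q) (Θ Ξ : ℕ) (Λ : ℕ × ℕ)
    (hΘ_min : ∀ (I : Instance σ C) (u v : C), IsTight Q I u v → Θ ≤ weight I u v)
    (hΞ_min : ∀ (I : Instance σ C) (u v : C), IsTight Q I u v → weight I u v = Θ →
      Ξ ≤ extraWeight I u v)
    (hΛ_ex : ∃ (I : Instance σ C) (u v : C), IsTight Q I u v ∧ weight I u v = Θ ∧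
      extraWeight I u v = Ξ ∧ lexWeight I u v = Λ)
    (hΛ_min : ∀ (I : Instance σ C) (u v : C), IsTight Q I u v → weight I u v = Θ →
      extraWeight I u v = Ξ → ¬ lexLt (lexWeight I u v) Λ) :
    ∃ (I : Instance σ C) (u v : C),
      MinimalModel Q I ∧ IsTight Q I u v ∧ Clean I u v ∧
      weight I u v = Θ ∧ extraWeight I u v = Ξ ∧ lexWeight I u v = Λ := by
  have key : ∀ (n m : ℕ) (I : Instance σ C) (u v : C), (touching I u v).card = n → I.card = m →
      IsTight Q I u v → weight I u v = Θ → extraWeight I u v = Ξ → lexWeight I u v = Λ →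
      ∃ (I : Instance σ C) (u v : C),
      MinimalModel Q I ∧ IsTight Q I u v ∧ Clean I u v ∧
      weight I u v = Θ ∧ extraWeight I u v = Ξ ∧ lexWeight I u v = Λ := by
    intro n
    induction n using Nat.strong_induction_on with
    | _ n ihn =>
    intro m
    induction m using Nat.strong_induction_on with
    | _ m ihm =>
    intro I u v hn hm ht h1 h2 h3
    have huv : u ≠ v := ht.1.1.1
    by_cases hmin : MinimalModel Q I
    · by_cases hcl : Clean I u v
      · exact ⟨I, u, v, hmin, ht, hcl, h1, h2, h3⟩
      · have hstep : ∃ K, Q K ∧ Touch K I u v ∧ Ret K I u v ∧ touching K u v ⊂ touching I u v := by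
          unfold Clean at hcl
          rw [not_and_or] at hcl
          push Not at hcl
          rcases hcl with ⟨t, hg⟩ | ⟨w, hg⟩
          · exact garbage_step hQ huv hmin.1
              (fun x y h => by rw [h1]; exact hΘ_min I x y h) ht.1.1.2 hg
          · obtain ⟨K, hK, T, R, hs⟩ := garbage_step hQ huv.symm hmin.1
              (fun x y h => by
                have : weight I v u = Θ := by rw [← h1]; simp only [weight, cov_comm I u v]
                rw [this]; exact hΘ_min I x y h)
              (by rw [cov_comm]; exact ht.1.1.2) (garb_comm.1 hg)
            exact ⟨K, hK, T.symm, R.symm, by rwa [touching_comm K, touching_comm I]⟩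
        obtain ⟨K, hK, T, R, hs⟩ := hstep
        obtain ⟨k0, k1, k2, k3⟩ :=
          params_transfer hQ hΘ_min hΞ_min hΛ_min T R hK ht h1 h2 h3
        exact ihn _ (hn ▸ Finset.card_lt_card hs) _ K u v rfl rfl k0 k1 k2 k3
    · have : ∃ J, J ⊂ I ∧ Q J := by
        unfold MinimalModel at hmin
        by_contra hcon
        push Not at hcon
        exact hmin ⟨ht.2.1, hcon⟩
      obtain ⟨J, hJ, hQJ⟩ := this
      have T : Touch J I u v := fun F hF _ => hJ.1 hF
      have R : Ret J I u v := ⟨id, rfl, rfl, fun F hF => hJ.1 hF, fun F _ h => h⟩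
      obtain ⟨k0, k1, k2, k3⟩ :=
        params_transfer hQ hΘ_min hΞ_min hΛ_min T R hQJ ht h1 h2 h3
      have hle : (touching J u v).card ≤ n := by
        rw [← hn]
        exact Finset.card_le_card (Finset.filter_subset_filter _ hJ.1)
      rcases hle.lt_or_eq with h | h
      · exact ihn _ h _ J u v rfl rfl k0 k1 k2 k3
      · exact ihm _ (hm ▸ Finset.card_lt_card hJ) J u v h rfl k0 k1 k2 k3
  obtain ⟨I, u, v, ht, h1, h2, h3⟩ := hΛ_ex
  exact key _ _ I u v rfl rfl ht h1 h2 h3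

end helpers

/-- if a homomorphism-closed query `Q` has a model with a tight edge, then `Q` has
a critical model: a subinstance-minimal model `I` of `Q` with a clean tight edge `(u,v)` of
weight the critical weight `Θ`, extra weight the critical extra weight `Ξ`, lexicographic
weight the critical lexicographic weight `Λ`, together with a left-incident fact `FL` and a
right-incident fact `FR` of `(u,v)` in `I`. -/
theorem exists_critical_model {σ C : Type} [Infinite C]
    (Q : Instance σ C → Prop) (hQ : HomClosed Q) (Θ Ξ : ℕ) (Λ : ℕ × ℕ)
    (hΘ_ex : ∃ (I : Instance σ C) (u v : C), IsTight Q I u v ∧ weight I u v = Θ)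
    (hΘ_min : ∀ (I : Instance σ C) (u v : C), IsTight Q I u v → Θ ≤ weight I u v)
    (hΞ_ex : ∃ (I : Instance σ C) (u v : C), IsTight Q I u v ∧ weight I u v = Θ ∧
      extraWeight I u v = Ξ)
    (hΞ_min : ∀ (I : Instance σ C) (u v : C), IsTight Q I u v → weight I u v = Θ →
      Ξ ≤ extraWeight I u v)
    (hΛ_ex : ∃ (I : Instance σ C) (u v : C), IsTight Q I u v ∧ weight I u v = Θ ∧
      extraWeight I u v = Ξ ∧ lexWeight I u v = Λ)
    (hΛ_min : ∀ (I : Instance σ C) (u v : C), IsTight Q I u v → weight I u v = Θ →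
      extraWeight I u v = Ξ → ¬ lexLt (lexWeight I u v) Λ) :
    ∃ (I : Instance σ C) (u v : C) (FL FR : Fact σ C),
      MinimalModel Q I ∧ IsTight Q I u v ∧ Clean I u v ∧
      weight I u v = Θ ∧ extraWeight I u v = Ξ ∧ lexWeight I u v = Λ ∧
      FL ∈ leftIncident I u v ∧ FR ∈ leftIncident I v u := by
  obtain ⟨I, u, v, hm, ht, hc, h⟩ := main_aux Q hQ Θ Ξ Λ hΘ_min hΞ_min hΛ_ex hΛ_min
  obtain ⟨FL, hL⟩ := ht.1.2.1
  obtain ⟨FR, hR⟩ := ht.1.2.2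
  exact ⟨I, u, v, FL, FR, hm, ht, hc, h.1, h.2.1, h.2.2, hL, hR⟩

end UR
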